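/- arXiv:2412.13583 — 2 statements merged into one kernel-verified Lean document; each statement's English description precedes it below -/
import Mathlib

section
/- Let β = log 5/log 2 and ℓ ≥ 1. Let V : 𝔾_ℓ → [0,∞) be any nonnegative function, and define Ṽ(x) = min{V(x)/2, (5/2)·2^{−ℓβ}}. Then the smallest eigenvalue E₀ of the operator −Δ^{𝔾_ℓ,N} + V/2 on ℓ²(𝔾_ℓ) satisfies E₀ ≥ (1/(2|𝔾_ℓ|))·Σ_{x∈𝔾_ℓ} Ṽ(x), where |𝔾_ℓ| = (3^{ℓ+1}+3)/2. -/
open scoped Classical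

noncomputable section

namespace SGL

/-- The vector `a₂ = (1,0)`. -/
def a2 : ℝ × ℝ := (1, 0)

/-- The vector `a₃ = (1/2, √3/2)`. -/
def a3 : ℝ × ℝ := (1/2, Real.sqrt 3 / 2)

/-- The vertex set of the unit triangle with lower-left corner `t`. -/
def tri (t : ℝ × ℝ) : Finset (ℝ × ℝ) := {t, t + a2, t + a3}

/-- The lower-left corners of the unit triangles making up `Tₙ`:
`T_{n+1} = T_n ∪ (T_n + 2ⁿ a₂) ∪ (T_n + 2ⁿ a₃)`. -/
def baseSet : ℕ → Finset (ℝ × ℝ)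
  | 0 => {(0, 0)}
  | (n+1) => baseSet n ∪ (baseSet n).image (· + (2 ^ n : ℝ) • a2)
      ∪ (baseSet n).image (· + (2 ^ n : ℝ) • a3)

/-- `𝔾ₙ`: the set of all vertices of the unit triangles composing `Tₙ`. -/
def VtxF (n : ℕ) : Finset (ℝ × ℝ) := (baseSet n).biUnion tri

/-- Reflection across the `y`-axis. -/
def reflY (p : ℝ × ℝ) : ℝ × ℝ := (-p.1, p.2)

/-- `(x,y) ∈ ℰₙ`: `x ≠ y` lie in a common unit triangle of `Tₙ`. -/
def EdgeIn (n : ℕ) (x y : ℝ × ℝ) : Prop :=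
  ∃ t ∈ baseSet n, x ∈ tri t ∧ y ∈ tri t ∧ x ≠ y

/-- Adjacency in the full Sierpinski lattice: an edge of some `ℰₙ` or of its mirror `ℰₙ′`. -/
def Adj (x y : ℝ × ℝ) : Prop :=
  (∃ n, EdgeIn n x y) ∨ (∃ n, EdgeIn n (reflY x) (reflY y))

/-- The vertex set `𝔾 = ⋃ₙ (𝔾ₙ ∪ 𝔾ₙ′)` of the full Sierpinski lattice. -/
def SG : Set (ℝ × ℝ) :=
  (⋃ n, (VtxF n : Set (ℝ × ℝ))) ∪ reflY '' (⋃ n, (VtxF n : Set (ℝ × ℝ)))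

/-- The type of vertices of the Sierpinski lattice. -/
abbrev Gpt := {p : ℝ × ℝ // p ∈ SG}

/-- `ℓ²(𝔾)` with real coefficients. -/
abbrev l2G := lp (fun _ : Gpt => ℝ) 2

/-- The essential support of a measure on `ℝ`. -/
def essSupp (P₀ : MeasureTheory.Measure ℝ) : Set ℝ :=
  {t : ℝ | ∀ ε > 0, 0 < P₀ (Set.Ioo (t - ε) (t + ε))}

end SGL

end

namespace SGL

/-- Degree of `x` in the full Sierpinski lattice `𝔾`. -/
noncomputable def degG (x : ℝ × ℝ) : ℕ := Set.ncard {y : ℝ × ℝ | Adj x y}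

/-- Degree of `x` within the subgraph induced by the finite vertex set `A`. -/
noncomputable def degIn (A : Finset (ℝ × ℝ)) (x : ℝ × ℝ) : ℕ :=
  (A.filter fun y => Adj x y).card

/-- Diagonal term for the three boundary conditions: `0 = S` (simple, i.e. `deg(x)`),
`1 = N` (Neumann, i.e. `deg_A(x)`), `2 = D` (modified Dirichlet, i.e. `2deg(x) − deg_A(x)`). -/
noncomputable def bcDiag : Fin 3 → Finset (ℝ × ℝ) → (ℝ × ℝ) → ℝ
  | 0, _, x => (degG x : ℝ)
  | 1, A, x => (degIn A x : ℝ)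
  | 2, A, x => 2 * (degG x : ℝ) - (degIn A x : ℝ)

/-- The matrix of `H^{A,•} = −Δ^{A,•} + V|_A` acting on `ℓ²(A)`, for boundary condition `b`. -/
noncomputable def HMat (b : Fin 3) (A : Finset (ℝ × ℝ)) (V : ℝ × ℝ → ℝ) :
    Matrix A A ℝ := fun x y =>
  (if (x : ℝ × ℝ) = (y : ℝ × ℝ) then bcDiag b A (x : ℝ × ℝ) + V (x : ℝ × ℝ) else 0)
    - (if Adj (x : ℝ × ℝ) (y : ℝ × ℝ) then 1 else 0)

/-- The eigenvalue counting function `𝒩(E;M)`: the number of eigenvalues of `M` that are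
`≤ E`, counted with multiplicity (the dimension of the span of the eigenspaces with
eigenvalue `≤ E`; for symmetric `M` this is the usual count). -/
noncomputable def evCount {ι : Type} [Fintype ι] (M : Matrix ι ι ℝ) (E : ℝ) : ℕ :=
  Module.finrank ℝ
    ↥(⨆ μ : {μ : ℝ // μ ≤ E}, Module.End.eigenspace (Matrix.mulVecLin M) (μ : ℝ))

/-- The three corner (extreme) vertices of `𝔾_ℓ`. -/
noncomputable def cornerF (ℓ : ℕ) : Finset (ℝ × ℝ) :=
  {(0, 0), (2 ^ ℓ : ℝ) • a2, (2 ^ ℓ : ℝ) • a3}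

/-- The truncated triangle `G̃_ℓ = 𝔾_ℓ` minus its three extreme vertices. -/
noncomputable def TruncF (ℓ : ℕ) : Finset (ℝ × ℝ) := VtxF ℓ \ cornerF ℓ

end SGL

open SGL

namespace SGL

/-- The coordinate sum `i + j` of `i • a2 + j • a3`. -/
noncomputable def latticeHeight (p : ℝ × ℝ) : ℝ := p.1 + p.2 / Real.sqrt 3

/-- The coordinate `j` of `i • a2 + j • a3`. -/
noncomputable def latticeRow (p : ℝ × ℝ) : ℝ := 2 * p.2 / Real.sqrt 3

lemma latticeHeight_add_smul_a2 (p : ℝ × ℝ) (c : ℝ) :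
    latticeHeight (p + c • a2) = latticeHeight p + c := by
  simp [latticeHeight, a2]; ring

lemma latticeHeight_add_smul_a3 (p : ℝ × ℝ) (c : ℝ) :
    latticeHeight (p + c • a3) = latticeHeight p + c := by
  have h : Real.sqrt 3 ≠ 0 := by positivity
  simp only [latticeHeight, a3, Prod.fst_add, Prod.snd_add, Prod.smul_fst, Prod.smul_snd,
    smul_eq_mul]
  field_simp
  ring

lemma latticeRow_add_smul_a2 (p : ℝ × ℝ) (c : ℝ) :
    latticeRow (p + c • a2) = latticeRow p := by
  simp [latticeRow, a2]

lemma latticeRow_add_smul_a3 (p : ℝ × ℝ) (c : ℝ) :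
    latticeRow (p + c • a3) = latticeRow p + c := by
  have h : Real.sqrt 3 ≠ 0 := by positivity
  simp only [latticeRow, a3, Prod.snd_add, Prod.smul_snd, smul_eq_mul]
  field_simp

lemma baseSet_bounds (n : ℕ) : ∀ t ∈ baseSet n,
    0 ≤ latticeRow t ∧ latticeRow t ≤ latticeHeight t ∧ latticeHeight t ≤ 2 ^ n - 1 := by
  induction n with
  | zero => simp [baseSet, latticeRow, latticeHeight]
  | succ n ih =>
    have h2 : (0 : ℝ) < 2 ^ n := by positivity
    intro t ht
    simp only [baseSet, Finset.mem_union, Finset.mem_image] at ht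
    rw [pow_succ]
    rcases ht with (ht | ⟨s, hs, rfl⟩) | ⟨s, hs, rfl⟩
    · obtain ⟨h, h', h''⟩ := ih t ht
      exact ⟨h, h', by linarith⟩
    · obtain ⟨h, h', h''⟩ := ih s hs
      rw [latticeRow_add_smul_a2, latticeHeight_add_smul_a2]
      exact ⟨h, by linarith, by linarith⟩
    · obtain ⟨h, h', h''⟩ := ih s hs
      rw [latticeRow_add_smul_a3, latticeHeight_add_smul_a3]
      exact ⟨by linarith, by linarith, by linarith⟩

lemma sum_baseSet_succ (n : ℕ) (φ : ℝ × ℝ → ℝ) :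
    ∑ t ∈ baseSet (n + 1), φ t = ∑ t ∈ baseSet n, φ t
      + ∑ t ∈ baseSet n, φ (t + (2 ^ n : ℝ) • a2)
      + ∑ t ∈ baseSet n, φ (t + (2 ^ n : ℝ) • a3) := by
  rw [baseSet, Finset.sum_union, Finset.sum_union, Finset.sum_image, Finset.sum_image]
  · intro x _ y _ h
    exact add_right_cancel h
  · intro x _ y _ h
    exact add_right_cancel h
  · rw [Finset.disjoint_left]
    intro t ht ht'
    obtain ⟨s, hs, rfl⟩ := Finset.mem_image.1 ht'
    have h := baseSet_bounds n _ ht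
    have h' := baseSet_bounds n _ hs
    rw [latticeHeight_add_smul_a2] at h
    linarith
  · rw [Finset.disjoint_left]
    intro t ht ht'
    obtain ⟨s, hs, rfl⟩ := Finset.mem_image.1 ht'
    have h' := baseSet_bounds n _ hs
    rcases Finset.mem_union.1 ht with ht | ht
    · have h := baseSet_bounds n _ ht
      rw [latticeHeight_add_smul_a3] at h
      linarith
    · obtain ⟨r, hr, hrs⟩ := Finset.mem_image.1 ht
      have h := baseSet_bounds n _ hr
      have e := congrArg latticeRow hrs
      simp only [latticeRow_add_smul_a2, latticeRow_add_smul_a3] at e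
      linarith

/-- The sum of `f` over the vertices of all unit triangles of `Tₙ`, with multiplicity. -/
noncomputable def triSum (n : ℕ) (f : ℝ × ℝ → ℝ) : ℝ :=
  ∑ t ∈ baseSet n, (f t + f (t + a2) + f (t + a3))

/-- The Dirichlet energy of `f` on `Tₙ`. -/
noncomputable def triEnergy (n : ℕ) (f : ℝ × ℝ → ℝ) : ℝ :=
  ∑ t ∈ baseSet n, ((f t - f (t + a2)) ^ 2 + (f t - f (t + a3)) ^ 2
    + (f (t + a2) - f (t + a3)) ^ 2)

/-- The mean of `f` over the vertices of the unit triangles of `Tₙ`, with multiplicity. -/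
noncomputable def triMean (n : ℕ) (f : ℝ × ℝ → ℝ) : ℝ := triSum n f / 3 ^ (n + 1)

lemma triSum_succ (n : ℕ) (f : ℝ × ℝ → ℝ) :
    triSum (n + 1) f = triSum n f + triSum n (fun x => f (x + (2 ^ n : ℝ) • a2))
      + triSum n (fun x => f (x + (2 ^ n : ℝ) • a3)) := by
  rw [triSum, sum_baseSet_succ]
  simp only [triSum, add_right_comm _ _ a2, add_right_comm _ _ a3]

lemma triEnergy_succ (n : ℕ) (f : ℝ × ℝ → ℝ) :
    triEnergy (n + 1) f = triEnergy n f + triEnergy n (fun x => f (x + (2 ^ n : ℝ) • a2))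
      + triEnergy n (fun x => f (x + (2 ^ n : ℝ) • a3)) := by
  rw [triEnergy, sum_baseSet_succ]
  simp only [triEnergy, add_right_comm _ _ a2, add_right_comm _ _ a3]

lemma triMean_succ (n : ℕ) (f : ℝ × ℝ → ℝ) :
    triMean (n + 1) f = (triMean n f + triMean n (fun x => f (x + (2 ^ n : ℝ) • a2))
      + triMean n (fun x => f (x + (2 ^ n : ℝ) • a3))) / 3 := by
  simp only [triMean, triSum_succ, pow_succ]
  field_simp

lemma triSum_const (n : ℕ) (c : ℝ) : triSum n (fun _ => c) = 3 ^ (n + 1) * c := by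
  induction n with
  | zero => simp [triSum, baseSet]; ring
  | succ n ih => rw [triSum_succ, ih]; ring

lemma triSum_sub_sq (n : ℕ) (f : ℝ × ℝ → ℝ) (c : ℝ) :
    triSum n (fun x => (f x - c) ^ 2)
      = triSum n (fun x => f x ^ 2) - 2 * c * triSum n f + 3 ^ (n + 1) * c ^ 2 := by
  rw [← triSum_const]
  simp only [triSum, Finset.mul_sum, ← Finset.sum_sub_distrib, ← Finset.sum_add_distrib]
  exact Finset.sum_congr rfl fun t _ => by ring

lemma corner_scalar_bound (c₁ c₂ c₃ m₁ m₂ m₃ p q r : ℝ) :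
    (c₁ - (m₁ + m₂ + m₃) / 3) ^ 2 + (c₂ - (m₁ + m₂ + m₃) / 3) ^ 2
        + (c₃ - (m₁ + m₂ + m₃) / 3) ^ 2
      ≤ 5 / 3 * (((c₁ - m₁) ^ 2 + (p - m₁) ^ 2 + (q - m₁) ^ 2)
        + ((p - m₂) ^ 2 + (c₂ - m₂) ^ 2 + (r - m₂) ^ 2)
        + ((q - m₃) ^ 2 + (r - m₃) ^ 2 + (c₃ - m₃) ^ 2)) := by
  have key : ∀ x y : ℝ, (x + y) ^ 2 ≤ 5 / 3 * x ^ 2 + 5 / 2 * y ^ 2 := fun x y => by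
    nlinarith [sq_nonneg (2 * x - 3 * y)]
  have h₁ := key (c₁ - m₁) (m₁ - (m₁ + m₂ + m₃) / 3)
  have h₂ := key (c₂ - m₂) (m₂ - (m₁ + m₂ + m₃) / 3)
  have h₃ := key (c₃ - m₃) (m₃ - (m₁ + m₂ + m₃) / 3)
  simp only [sub_add_sub_cancel] at h₁ h₂ h₃
  nlinarith [sq_nonneg (2 * p - m₁ - m₂), sq_nonneg (2 * q - m₁ - m₃),
    sq_nonneg (2 * r - m₂ - m₃)]

/-- The corner values of `f` deviate from its mean by at most `½ (5/3)ⁿ` times the energy. -/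
lemma sum_corner_sub_triMean_sq_le (n : ℕ) : ∀ f : ℝ × ℝ → ℝ,
    (f 0 - triMean n f) ^ 2 + (f ((2 ^ n : ℝ) • a2) - triMean n f) ^ 2
      + (f ((2 ^ n : ℝ) • a3) - triMean n f) ^ 2 ≤ 1 / 2 * (5 / 3) ^ n * triEnergy n f := by
  induction n with
  | zero =>
    intro f
    simp only [triMean, triSum, triEnergy, baseSet, Finset.sum_singleton, pow_zero, one_smul,
      ← Prod.zero_eq_mk, zero_add, pow_one]
    nlinarith [sq_nonneg (f 0 - f a2), sq_nonneg (f 0 - f a3), sq_nonneg (f a2 - f a3)]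
  | succ n ih =>
    intro f
    have h₁ := ih f
    have h₂ := ih fun x => f (x + (2 ^ n : ℝ) • a2)
    have h₃ := ih fun x => f (x + (2 ^ n : ℝ) • a3)
    have e : ∀ v : ℝ × ℝ, (2 ^ n : ℝ) • v + (2 ^ n : ℝ) • v = (2 ^ (n + 1) : ℝ) • v := by
      intro v
      rw [← add_smul, pow_succ, mul_two]
    simp only [zero_add, e] at h₂ h₃
    rw [add_comm ((2 ^ n : ℝ) • a2) ((2 ^ n : ℝ) • a3)] at h₃
    rw [triMean_succ, triEnergy_succ]
    refine (corner_scalar_bound _ _ _ _ _ _ _ _ _).trans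
      ((mul_le_mul_of_nonneg_left (add_le_add (add_le_add h₁ h₂) h₃) (by norm_num)).trans
        (le_of_eq ?_))
    ring

lemma sum_sq_sub_mean_sq_le (c₁ c₂ c₃ m₁ m₂ m₃ p q r : ℝ) :
    m₁ ^ 2 + m₂ ^ 2 + m₃ ^ 2 - 3 * ((m₁ + m₂ + m₃) / 3) ^ 2
      ≤ 2 / 3 * (((c₁ - m₁) ^ 2 + (p - m₁) ^ 2 + (q - m₁) ^ 2)
        + ((p - m₂) ^ 2 + (c₂ - m₂) ^ 2 + (r - m₂) ^ 2)
        + ((q - m₃) ^ 2 + (r - m₃) ^ 2 + (c₃ - m₃) ^ 2)) := by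
  nlinarith [sq_nonneg (2 * p - m₁ - m₂), sq_nonneg (2 * q - m₁ - m₃),
    sq_nonneg (2 * r - m₂ - m₃), sq_nonneg (c₁ - m₁), sq_nonneg (c₂ - m₂), sq_nonneg (c₃ - m₃)]

/-- Poincaré inequality on `Tₙ`. -/
lemma triSum_sq_sub_mean_le (n : ℕ) : ∀ f : ℝ × ℝ → ℝ,
    triSum n (fun x => f x ^ 2) - 3 ^ (n + 1) * triMean n f ^ 2
      ≤ (1 / 3 + (5 ^ n - 1) / 4) * triEnergy n f := by
  induction n with
  | zero =>
    intro f
    simp only [triMean, triSum, triEnergy, baseSet, Finset.sum_singleton, pow_zero,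
      ← Prod.zero_eq_mk, zero_add, pow_one]
    nlinarith
  | succ n ih =>
    intro f
    have h₁ := ih f
    have h₂ := ih fun x => f (x + (2 ^ n : ℝ) • a2)
    have h₃ := ih fun x => f (x + (2 ^ n : ℝ) • a3)
    have k₁ := sum_corner_sub_triMean_sq_le n f
    have k₂ := sum_corner_sub_triMean_sq_le n fun x => f (x + (2 ^ n : ℝ) • a2)
    have k₃ := sum_corner_sub_triMean_sq_le n fun x => f (x + (2 ^ n : ℝ) • a3)
    simp only [zero_add] at k₂ k₃
    rw [add_comm ((2 ^ n : ℝ) • a2) ((2 ^ n : ℝ) • a3)] at k₃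
    have k := (sum_sq_sub_mean_sq_le _ _ _ _ _ _ _ _ _).trans
      (mul_le_mul_of_nonneg_left (add_le_add (add_le_add k₁ k₂) k₃) (by norm_num))
    have k' := mul_le_mul_of_nonneg_left k (by positivity : (0 : ℝ) ≤ 3 ^ (n + 1))
    have e : (3 : ℝ) ^ n * (5 / 3) ^ n = 5 ^ n := by rw [← mul_pow]; norm_num
    rw [triMean_succ, triEnergy_succ, triSum_succ]
    set E₁ := triEnergy n f
    set E₂ := triEnergy n fun x => f (x + (2 ^ n : ℝ) • a2)
    set E₃ := triEnergy n fun x => f (x + (2 ^ n : ℝ) • a3)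
    have e' : (3 : ℝ) ^ (n + 1) * (2 / 3 * (1 / 2 * (5 / 3) ^ n * E₁ + 1 / 2 * (5 / 3) ^ n * E₂
        + 1 / 2 * (5 / 3) ^ n * E₃)) = 5 ^ n * (E₁ + E₂ + E₃) := by
      rw [← e]; ring
    rw [e'] at k'
    rw [pow_succ 3 (n + 1), pow_succ 5 n]
    linarith

lemma triEnergy_nonneg (n : ℕ) (f : ℝ × ℝ → ℝ) : 0 ≤ triEnergy n f :=
  Finset.sum_nonneg fun _ _ => by positivity

lemma triSum_sub_triMean_sq_le {n : ℕ} (hn : 1 ≤ n) (f : ℝ × ℝ → ℝ) :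
    triSum n (fun x => (f x - triMean n f) ^ 2) ≤ 4 / 15 * 5 ^ n * triEnergy n f := by
  have h := triSum_sq_sub_mean_le n f
  have hm : triSum n f = 3 ^ (n + 1) * triMean n f := by
    rw [triMean]; field_simp
  have h5 : (5 : ℝ) ≤ 5 ^ n := le_self_pow₀ (by norm_num) (by omega)
  have h' : (1 / 3 + (5 ^ n - 1) / 4) * triEnergy n f ≤ 4 / 15 * 5 ^ n * triEnergy n f :=
    mul_le_mul_of_nonneg_right (by linarith) (triEnergy_nonneg n f)
  rw [triSum_sub_sq, hm]
  linarith

lemma sum_vtxF_le_triSum (n : ℕ) {g : ℝ × ℝ → ℝ} (hg : ∀ x, 0 ≤ g x) :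
    ∑ x ∈ VtxF n, g x ≤ triSum n g := by
  have hsub : VtxF n ⊆ baseSet n ∪ (baseSet n).image (· + a2) ∪ (baseSet n).image (· + a3) := by
    intro x hx
    obtain ⟨t, ht, hx⟩ := Finset.mem_biUnion.1 hx
    simp only [tri, Finset.mem_insert, Finset.mem_singleton] at hx
    simp only [Finset.mem_union, Finset.mem_image]
    rcases hx with rfl | rfl | rfl
    · exact Or.inl (Or.inl ht)
    · exact Or.inl (Or.inr ⟨t, ht, rfl⟩)
    · exact Or.inr ⟨t, ht, rfl⟩
  have hunion : ∀ s t : Finset (ℝ × ℝ), ∑ x ∈ s ∪ t, g x ≤ ∑ x ∈ s, g x + ∑ x ∈ t, g x :=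
    fun s t => by
      rw [← Finset.sum_union_inter]
      exact le_add_of_nonneg_right (Finset.sum_nonneg fun x _ => hg x)
  have himage : ∀ v : ℝ × ℝ,
      ∑ x ∈ (baseSet n).image (· + v), g x = ∑ t ∈ baseSet n, g (t + v) := fun v =>
    Finset.sum_image fun _ _ _ _ h => add_right_cancel h
  rw [triSum, Finset.sum_add_distrib, Finset.sum_add_distrib, ← himage a2, ← himage a3]
  exact (Finset.sum_le_sum_of_subset_of_nonneg hsub fun x _ _ => hg x).trans
    ((hunion _ _).trans (add_le_add_left (hunion _ _) _))

lemma Adj.symm {x y : ℝ × ℝ} (h : Adj x y) : Adj y x := by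
  rcases h with ⟨n, t, ht, hx, hy, hne⟩ | ⟨n, t, ht, hx, hy, hne⟩
  · exact Or.inl ⟨n, t, ht, hy, hx, hne.symm⟩
  · exact Or.inr ⟨n, t, ht, hy, hx, hne.symm⟩

/-- The ordered pairs of adjacent vertices of `A`. -/
noncomputable def adjPairs (A : Finset (ℝ × ℝ)) : Finset ((ℝ × ℝ) × (ℝ × ℝ)) :=
  (A ×ˢ A).filter fun p => Adj p.1 p.2

/-- The oriented sides of the unit triangle at `t`. -/
noncomputable def side (t : ℝ × ℝ) : Fin 6 → (ℝ × ℝ) × (ℝ × ℝ) :=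
  ![(t, t + a2), (t, t + a3), (t + a2, t + a3), (t + a2, t), (t + a3, t), (t + a3, t + a2)]

lemma side_injective : Function.Injective fun q : (ℝ × ℝ) × Fin 6 => side q.1 q.2 := by
  have h3 : 0 < Real.sqrt 3 := by positivity
  rintro ⟨⟨x, y⟩, k⟩ ⟨⟨x', y'⟩, k'⟩ h
  fin_cases k <;> fin_cases k' <;>
    simp [side, a2, a3, Prod.ext_iff] at h ⊢ <;>
    first
    | exact h
    | (obtain ⟨⟨_, _⟩, _, _⟩ := h; linarith)

lemma side_mem_adjPairs {n : ℕ} {t : ℝ × ℝ} (ht : t ∈ baseSet n) (k : Fin 6) :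
    side t k ∈ adjPairs (VtxF n) := by
  have hmem : (side t k).1 ∈ tri t ∧ (side t k).2 ∈ tri t ∧ (side t k).1 ≠ (side t k).2 := by
    fin_cases k <;> simp [side, tri, a2, a3, Prod.ext_iff]
  simp only [adjPairs, Finset.mem_filter, Finset.mem_product, VtxF, Finset.mem_biUnion]
  exact ⟨⟨⟨t, ht, hmem.1⟩, ⟨t, ht, hmem.2.1⟩⟩, Or.inl ⟨n, t, ht, hmem⟩⟩

lemma two_mul_triEnergy_le (n : ℕ) (f : ℝ × ℝ → ℝ) :
    2 * triEnergy n f ≤ ∑ p ∈ adjPairs (VtxF n), (f p.1 - f p.2) ^ 2 := by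
  have himage : (baseSet n ×ˢ (Finset.univ : Finset (Fin 6))).image (fun q => side q.1 q.2)
      ⊆ adjPairs (VtxF n) := by
    intro p hp
    obtain ⟨q, hq, rfl⟩ := Finset.mem_image.1 hp
    exact side_mem_adjPairs (Finset.mem_product.1 hq).1 q.2
  refine le_trans (le_of_eq ?_)
    (Finset.sum_le_sum_of_subset_of_nonneg himage fun p _ _ => sq_nonneg _)
  rw [Finset.sum_image side_injective.injOn, Finset.sum_product, triEnergy, Finset.mul_sum]
  refine Finset.sum_congr rfl fun t _ => ?_
  simp [side, Fin.sum_univ_succ]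
  ring

lemma sum_adjPairs (A : Finset (ℝ × ℝ)) (f : ℝ × ℝ → ℝ) :
    ∑ p ∈ adjPairs A, (f p.1 - f p.2) ^ 2
      = 2 * ∑ x ∈ A, f x * (degIn A x * f x - ∑ y ∈ A, if Adj x y then f y else 0) := by
  have hdeg : ∀ x, (degIn A x : ℝ) = ∑ y ∈ A, if Adj x y then 1 else 0 := fun x => by
    rw [degIn, Finset.sum_boole]
  have hswap : ∑ x ∈ A, ∑ y ∈ A, (if Adj x y then f y ^ 2 else 0)
      = ∑ x ∈ A, ∑ y ∈ A, (if Adj x y then f x ^ 2 else 0) := by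
    rw [Finset.sum_comm]
    refine Finset.sum_congr rfl fun x _ => Finset.sum_congr rfl fun y _ => ?_
    exact if_congr ⟨Adj.symm, Adj.symm⟩ rfl rfl
  have hrhs : ∑ x ∈ A, f x * (degIn A x * f x - ∑ y ∈ A, if Adj x y then f y else 0)
      = ∑ x ∈ A, ∑ y ∈ A, (if Adj x y then f x ^ 2 else 0)
        - ∑ x ∈ A, ∑ y ∈ A, (if Adj x y then f x * f y else 0) := by
    simp only [hdeg, Finset.sum_mul, Finset.mul_sum, ← Finset.sum_sub_distrib]
    refine Finset.sum_congr rfl fun x _ => Finset.sum_congr rfl fun y _ => ?_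
    split_ifs <;> ring
  have hlhs : ∑ p ∈ adjPairs A, (f p.1 - f p.2) ^ 2
      = ∑ x ∈ A, ∑ y ∈ A, (if Adj x y then f x ^ 2 else 0)
        - 2 * ∑ x ∈ A, ∑ y ∈ A, (if Adj x y then f x * f y else 0)
        + ∑ x ∈ A, ∑ y ∈ A, (if Adj x y then f y ^ 2 else 0) := by
    rw [adjPairs, Finset.sum_filter, Finset.sum_product]
    simp only [Finset.mul_sum, ← Finset.sum_sub_distrib, ← Finset.sum_add_distrib]
    refine Finset.sum_congr rfl fun x _ => Finset.sum_congr rfl fun y _ => ?_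
    split_ifs <;> ring
  rw [hlhs, hrhs, hswap]
  ring

/-- An eigenvector extends by zero to a function on the plane satisfying the eigenvalue equation
on `A`. -/
lemma exists_eigenfunction {A : Finset (ℝ × ℝ)} {W : ℝ × ℝ → ℝ} {μ : ℝ}
    (h : Module.End.HasEigenvalue (Matrix.mulVecLin (HMat 1 A W)) μ) :
    ∃ f : ℝ × ℝ → ℝ, (∃ x ∈ A, f x ≠ 0) ∧ ∀ x ∈ A,
      degIn A x * f x - (∑ y ∈ A, if Adj x y then f y else 0) + W x * f x = μ * f x := by
  obtain ⟨v, hv⟩ := h.exists_hasEigenvector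
  let f : ℝ × ℝ → ℝ := fun x => if hx : x ∈ A then v ⟨x, hx⟩ else 0
  have hf : ∀ x : A, f x = v x := fun x => dif_pos x.2
  refine ⟨f, ?_, fun x hx => ?_⟩
  · obtain ⟨x, hx⟩ := Function.ne_iff.1 hv.2
    exact ⟨x, x.2, by rwa [hf]⟩
  · have e := congrFun hv.apply_eq_smul ⟨x, hx⟩
    rw [Matrix.mulVecLin_apply, Matrix.mulVec, dotProduct, Pi.smul_apply, smul_eq_mul,
      ← hf ⟨x, hx⟩] at e
    rw [← e]
    simp only [← hf, HMat, sub_mul, Finset.sum_sub_distrib, ite_mul, zero_mul, one_mul, bcDiag]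
    rw [Finset.sum_coe_sort A fun y => if x = y then (degIn A x + W x) * f y else 0,
      Finset.sum_coe_sort A fun y => if Adj x y then f y else 0, Finset.sum_ite_eq, if_pos hx]
    ring

lemma two_rpow_neg_mul_log_five (n : ℕ) :
    (2 : ℝ) ^ (-(n : ℝ) * (Real.log 5 / Real.log 2)) = ((5 : ℝ) ^ n)⁻¹ := by
  have h2 : Real.log 2 ≠ 0 := (Real.log_pos one_lt_two).ne'
  rw [Real.rpow_def_of_pos two_pos, show Real.log 2 * (-(n : ℝ) * (Real.log 5 / Real.log 2))
    = -(n * Real.log 5) by field_simp, Real.exp_neg, Real.exp_nat_mul,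
    Real.exp_log (by norm_num)]

lemma sum_sq_eq_mean_add_var {A : Finset (ℝ × ℝ)} (hA : A.Nonempty) (f : ℝ × ℝ → ℝ) (c : ℝ) :
    ∃ a : ℝ, ∑ x ∈ A, f x ^ 2 = A.card * a ^ 2 + ∑ x ∈ A, (f x - a) ^ 2
      ∧ ∑ x ∈ A, (f x - a) ^ 2 ≤ ∑ x ∈ A, (f x - c) ^ 2 := by
  have hN : (0 : ℝ) < A.card := by exact_mod_cast hA.card_pos
  have hexp : ∀ b : ℝ, ∑ x ∈ A, (f x - b) ^ 2
      = ∑ x ∈ A, f x ^ 2 - 2 * b * ∑ x ∈ A, f x + A.card * b ^ 2 := fun b => by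
    rw [← nsmul_eq_mul, ← Finset.sum_const, Finset.mul_sum, ← Finset.sum_sub_distrib,
      ← Finset.sum_add_distrib]
    exact Finset.sum_congr rfl fun x _ => by ring
  have hsum : ∑ x ∈ A, f x = A.card * ((∑ x ∈ A, f x) / A.card) := by field_simp
  refine ⟨(∑ x ∈ A, f x) / A.card, ?_, ?_⟩
  · rw [hexp]
    linear_combination 2 * ((∑ x ∈ A, f x) / A.card) * hsum
  · rw [hexp, hexp]
    set a := (∑ x ∈ A, f x) / A.card
    rw [hsum]
    nlinarith [mul_nonneg hN.le (sq_nonneg (a - c))]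

/-- Temple-type estimate: a potential bounded by `M` raises the ground state energy of a form with
spectral gap `3M/2` by at least half its average. -/
lemma half_average_mul_le {A : Finset (ℝ × ℝ)} (hA : A.Nonempty) {w f : ℝ × ℝ → ℝ} {M E c : ℝ}
    (hw : ∀ x ∈ A, 0 ≤ w x) (hM : ∀ x ∈ A, w x ≤ M)
    (hE : 3 / 2 * M * ∑ x ∈ A, (f x - c) ^ 2 ≤ E) :
    1 / (2 * (A.card : ℝ)) * (∑ x ∈ A, w x) * ∑ x ∈ A, f x ^ 2
      ≤ E + ∑ x ∈ A, w x * f x ^ 2 := by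
  have hN : (0 : ℝ) < A.card := by exact_mod_cast hA.card_pos
  obtain ⟨x₀, hx₀⟩ := hA
  have hM0 : 0 ≤ M := (hw x₀ hx₀).trans (hM x₀ hx₀)
  obtain ⟨a, ha, hvar⟩ := sum_sq_eq_mean_add_var ⟨x₀, hx₀⟩ f c
  have hpot : a ^ 2 / 2 * ∑ x ∈ A, w x - M * ∑ x ∈ A, (f x - a) ^ 2
      ≤ ∑ x ∈ A, w x * f x ^ 2 := by
    rw [Finset.mul_sum, Finset.mul_sum, ← Finset.sum_sub_distrib]
    refine Finset.sum_le_sum fun x hx => ?_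
    have h₁ := mul_nonneg (hw x hx) (sq_nonneg (2 * f x - a))
    have h₂ := mul_le_mul_of_nonneg_right (hM x hx) (sq_nonneg (f x - a))
    linarith
  have hav : 1 / (2 * (A.card : ℝ)) * ∑ x ∈ A, w x ≤ M / 2 := by
    have h : ∑ x ∈ A, w x ≤ A.card * M := by
      simpa using Finset.sum_le_card_nsmul A w M hM
    rw [one_div_mul_eq_div, div_le_iff₀ (by positivity)]
    linarith
  have hgap := mul_le_mul_of_nonneg_left hvar (by positivity : 0 ≤ 3 / 2 * M)
  have hav' := mul_le_mul_of_nonneg_right hav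
    (Finset.sum_nonneg fun x (_ : x ∈ A) => sq_nonneg (f x - a))
  have hconst : 1 / (2 * (A.card : ℝ)) * (∑ x ∈ A, w x) * (A.card * a ^ 2)
      = a ^ 2 / 2 * ∑ x ∈ A, w x := by field_simp
  rw [ha, mul_add, hconst]
  linarith

end SGL

/-- (Temple-inequality lower bound.) Let `β = log 5/log 2`, `ℓ ≥ 1`, let
`V : 𝔾_ℓ → [0,∞)` be nonnegative, and `Ṽ(x) = min{V(x)/2, (5/2)·2^{−ℓβ}}`. Then every
eigenvalue (in particular the smallest eigenvalue `E₀`) of `−Δ^{𝔾_ℓ,N} + V/2` is at least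
`(1/(2|𝔾_ℓ|))·Σ_{x∈𝔾_ℓ} Ṽ(x)`. -/
theorem temple_ground_state_lower_bound (ℓ : ℕ) (hℓ : 1 ≤ ℓ)
    (V : ℝ × ℝ → ℝ) (hV : ∀ x ∈ VtxF ℓ, 0 ≤ V x) :
    ∀ μ : ℝ,
      Module.End.HasEigenvalue
        (Matrix.mulVecLin (HMat 1 (VtxF ℓ) (fun x => V x / 2))) μ →
      (1 / (2 * ((VtxF ℓ).card : ℝ)))
          * ∑ x ∈ VtxF ℓ,
              min (V x / 2) ((5 / 2) * (2 : ℝ) ^ (-(ℓ : ℝ) * (Real.log 5 / Real.log 2)))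
        ≤ μ := by
  intro μ hμ
  rw [two_rpow_neg_mul_log_five]
  obtain ⟨f, ⟨x₀, hx₀, hfx₀⟩, hf⟩ := exists_eigenfunction hμ
  set w : ℝ × ℝ → ℝ := fun x => min (V x / 2) (5 / 2 * ((5 : ℝ) ^ ℓ)⁻¹)
  have hnorm : 0 < ∑ x ∈ VtxF ℓ, f x ^ 2 :=
    Finset.sum_pos' (fun x _ => sq_nonneg _) ⟨x₀, hx₀, by positivity⟩
  have hgap : 3 / 2 * (5 / 2 * ((5 : ℝ) ^ ℓ)⁻¹) * ∑ x ∈ VtxF ℓ, (f x - triMean ℓ f) ^ 2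
      ≤ triEnergy ℓ f := by
    have h := (sum_vtxF_le_triSum ℓ fun x => sq_nonneg (f x - triMean ℓ f)).trans
      (triSum_sub_triMean_sq_le hℓ f)
    refine (mul_le_mul_of_nonneg_left h (by positivity)).trans_eq ?_
    field_simp
    norm_num
  have hle := half_average_mul_le (w := w) ⟨x₀, hx₀⟩
    (fun x hx => le_min (by linarith [hV x hx]) (by positivity))
    (fun x _ => min_le_right _ _) hgap
  have hform : triEnergy ℓ f + ∑ x ∈ VtxF ℓ, w x * f x ^ 2 ≤ μ * ∑ x ∈ VtxF ℓ, f x ^ 2 := by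
    have hE := two_mul_triEnergy_le ℓ f
    rw [sum_adjPairs] at hE
    have hw : ∑ x ∈ VtxF ℓ, w x * f x ^ 2 ≤ ∑ x ∈ VtxF ℓ, V x / 2 * f x ^ 2 :=
      Finset.sum_le_sum fun x _ =>
        mul_le_mul_of_nonneg_right (min_le_left _ _) (sq_nonneg _)
    have hμ' : ∑ x ∈ VtxF ℓ, f x * (degIn (VtxF ℓ) x * f x
          - ∑ y ∈ VtxF ℓ, if Adj x y then f y else 0)
        + ∑ x ∈ VtxF ℓ, V x / 2 * f x ^ 2 = μ * ∑ x ∈ VtxF ℓ, f x ^ 2 := by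
      rw [Finset.mul_sum, ← Finset.sum_add_distrib]
      exact Finset.sum_congr rfl fun x hx => by linear_combination f x * hf x hx
    linarith
  exact le_of_mul_le_mul_right (hle.trans hform) hnorm
end

section
/- Let f(x) = (−5 + √(25 + 16x))/8. Then f maps [−1,0] into [−1,0], and for every integer n ≥ 0 and every x ∈ [−1,0], the n-fold iterate f^{∘n} satisfies (4/5ⁿ)·x ≤ f^{∘n}(x) ≤ x/5ⁿ ≤ 0. In particular, for −1 ≤ x ≤ 0 one has x(1−x)/5 ≤ f(x) ≤ x/5. -/
noncomputable section

/-- The decimation function `f(x) = (−5 + √(25 + 16x))/8`, the larger preimage of `x` under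
`z ↦ z(4z+5)`. -/
noncomputable def decf (x : ℝ) : ℝ := (-5 + Real.sqrt (25 + 16 * x)) / 8

theorem decf_mul_self {x : ℝ} (hx : -1 ≤ x) : decf x * (4 * decf x + 5) = x := by
  have h := Real.sq_sqrt (show (0 : ℝ) ≤ 25 + 16 * x by linarith)
  unfold decf
  linear_combination h / 16

theorem neg_quarter_le_decf {x : ℝ} (hx : -1 ≤ x) : -1 / 4 ≤ decf x := by
  have h : (3 : ℝ) ≤ Real.sqrt (25 + 16 * x) := Real.le_sqrt_of_sq_le (by linarith)
  unfold decf
  linarith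

theorem decf_le_div_five {x : ℝ} (hx : -1 ≤ x) : decf x ≤ x / 5 := by
  have h := decf_mul_self hx
  nlinarith [sq_nonneg (decf x)]

theorem mul_one_sub_div_five_le_decf {x : ℝ} (hx : x ∈ Set.Icc (-1 : ℝ) 0) :
    x * (1 - x) / 5 ≤ decf x := by
  obtain ⟨h1, h0⟩ := hx
  have h : 5 + 8 * (x * (1 - x) / 5) ≤ Real.sqrt (25 + 16 * x) := by
    apply Real.le_sqrt_of_sq_le
    have h2 : 0 ≤ 25 - 4 * (1 - x) ^ 2 := by nlinarith
    nlinarith [mul_nonneg (sq_nonneg x) h2]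
  unfold decf
  linarith

theorem decf_mem_Icc {x : ℝ} (hx : x ∈ Set.Icc (-1 : ℝ) 0) : decf x ∈ Set.Icc (-1 : ℝ) 0 := by
  have h1 := neg_quarter_le_decf hx.1
  have h2 := decf_le_div_five hx.1
  exact ⟨by linarith, by linarith [hx.2]⟩

theorem div_four_add_div_five_le {x : ℝ} (hx : x ∈ Set.Icc (-1 : ℝ) 0) :
    x / (4 + x) / 5 ≤ decf x / (4 + decf x) := by
  have hz := neg_quarter_le_decf hx.1
  have h := decf_mul_self hx.1
  have hx4 : 0 < 4 + x := by linarith [hx.1]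
  rw [div_div, div_le_div_iff₀ (by positivity) (by linarith)]
  generalize decf x = z at *
  subst h
  nlinarith [mul_nonneg (sq_nonneg z) (show 0 ≤ 4 * z + 1 by linarith)]

theorem decf_iterate_le {n : ℕ} {x : ℝ} (hx : x ∈ Set.Icc (-1 : ℝ) 0) :
    decf^[n] x ≤ x / 5 ^ n := by
  induction n generalizing x with
  | zero => simp
  | succ n ih =>
    rw [Function.iterate_succ_apply, pow_succ', ← div_div]
    refine (ih (decf_mem_Icc hx)).trans ?_
    gcongr
    exact decf_le_div_five hx.1

theorem four_mul_div_le_decf_iterate {n : ℕ} {x : ℝ} (hx : x ∈ Set.Icc (-1 : ℝ) 0) :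
    4 * (x / (4 + x) / 5 ^ n) ≤ decf^[n] x := by
  induction n generalizing x with
  | zero =>
    have hx4 : 0 < 4 + x := by linarith [hx.1]
    rw [pow_zero, div_one, Function.iterate_zero_apply, ← mul_div_assoc, div_le_iff₀ hx4]
    nlinarith [sq_nonneg x]
  | succ n ih =>
    rw [Function.iterate_succ_apply, pow_succ', ← div_div]
    refine le_trans ?_ (ih (decf_mem_Icc hx))
    gcongr 4 * (?_ / _)
    exact div_four_add_div_five_le hx

/-- `f` maps `[−1,0]` into itself, the iterates satisfy
`(4/5ⁿ)x ≤ f^{∘n}(x) ≤ x/5ⁿ ≤ 0` on `[−1,0]`, and in particular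
`x(1−x)/5 ≤ f(x) ≤ x/5` on `[−1,0]`. -/
theorem decf_iterate_bounds :
    (∀ x ∈ Set.Icc (-1 : ℝ) 0, decf x ∈ Set.Icc (-1 : ℝ) 0) ∧
    (∀ n : ℕ, ∀ x ∈ Set.Icc (-1 : ℝ) 0,
      (4 / 5 ^ n) * x ≤ decf^[n] x ∧ decf^[n] x ≤ x / 5 ^ n ∧ x / 5 ^ n ≤ 0) ∧
    (∀ x ∈ Set.Icc (-1 : ℝ) 0, x * (1 - x) / 5 ≤ decf x ∧ decf x ≤ x / 5) := by
  refine ⟨fun x hx => decf_mem_Icc hx, fun n x hx => ⟨?_, decf_iterate_le hx, ?_⟩,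
    fun x hx => ⟨mul_one_sub_div_five_le_decf hx, decf_le_div_five hx.1⟩⟩
  · refine le_trans ?_ (four_mul_div_le_decf_iterate hx)
    rw [div_mul_eq_mul_div, mul_div_assoc]
    gcongr
    rw [le_div_iff₀ (by linarith [hx.1])]
    nlinarith [hx.1, hx.2]
  · exact div_nonpos_of_nonpos_of_nonneg hx.2 (by positivity)
end
end
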